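/- For the generic quadratic model f with an admissible design x_1,…,x_n, true parameter θ* ∈ ℝ^{d+1}, Gaussian noise of standard deviation σ > 0, and noise-free observations y = y*: if all quadratic coefficients β_k are nonzero and have the same sign (all β_k > 0 or all β_k < 0), and the sigma-point parameter satisfies κ ∈ (2n, ∞), then for every x ∈ [−1,1]^d \ {−1,1}^d (i.e., at least one coordinate x_k lies in the open interval (−1,1)), the strict inequalities V^LIN(x) < V(x) < V^SP(x) hold. -/

import Mathlib

open Finset MeasureTheory Real

/-- The generic quadratic model
`f(x,θ) = θ₀ + ∑ₖ αₖ θₖ xₖ + ∑ₖ βₖ (θₖ²/2) xₖ²`. -/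
noncomputable def model (d : ℕ) (α β : Fin d → ℝ) (x : Fin d → ℝ)
    (θ : Fin (d + 1) → ℝ) : ℝ :=
  θ 0 + (∑ k, α k * θ k.succ * x k) + (∑ k, β k * (θ k.succ) ^ 2 / 2 * (x k) ^ 2)

/-- Admissibility of an experimental design: all design points are corners of `[-1,1]^d`,
they sum to zero, and the design is orthogonal. -/
def Admissible (d n : ℕ) (X : Fin n → Fin d → ℝ) : Prop :=
  (∀ i k, X i k = 1 ∨ X i k = -1) ∧
  (∀ k, ∑ i, X i k = 0) ∧
  (∀ k l, ∑ i, X i k * X i l = (n : ℝ) * (if k = l then 1 else 0))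

/-- The closed-form least-squares estimator for the generic quadratic model. -/
noncomputable def lse (d n : ℕ) (α β : Fin d → ℝ) (X : Fin n → Fin d → ℝ)
    (y : Fin n → ℝ) : Fin (d + 1) → ℝ :=
  Fin.cons
    ((1 / (n : ℝ)) * (∑ i, y i)
      - ∑ k, β k / (2 * (α k) ^ 2 * (n : ℝ) ^ 2) * (∑ i, X i k * y i) ^ 2)
    (fun k => (1 / (α k * (n : ℝ))) * ∑ i, X i k * y i)

/-- The sum of squared errors. -/
noncomputable def sse (d n : ℕ) (α β : Fin d → ℝ) (X : Fin n → Fin d → ℝ)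
    (y : Fin n → ℝ) (θ : Fin (d + 1) → ℝ) : ℝ :=
  ∑ i, (model d α β (X i) θ - y i) ^ 2

/-- Density of the `n`-dimensional Gaussian with mean `0` and covariance `σ² I`. -/
noncomputable def gauss (n : ℕ) (σ : ℝ) (z : Fin n → ℝ) : ℝ :=
  (2 * π * σ ^ 2) ^ (-(n : ℝ) / 2) * Real.exp (-(∑ i, (z i) ^ 2) / (2 * σ ^ 2))

/-- The noise-free observations `y* = (f(x₁,θ*),…,f(xₙ,θ*))`. -/
noncomputable def yStar (d n : ℕ) (α β : Fin d → ℝ) (X : Fin n → Fin d → ℝ)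
    (θs : Fin (d + 1) → ℝ) : Fin n → ℝ :=
  fun i => model d α β (X i) θs

/-- The expected prediction `μ(x) = ∫ f(x, θ̂(y* + z)) p(z) dz`. -/
noncomputable def predMean (d n : ℕ) (α β : Fin d → ℝ) (X : Fin n → Fin d → ℝ)
    (θs : Fin (d + 1) → ℝ) (σ : ℝ) (x : Fin d → ℝ) : ℝ :=
  ∫ z : Fin n → ℝ, model d α β x (lse d n α β X (yStar d n α β X θs + z)) * gauss n σ z

/-- The prediction uncertainty `V(x) = ∫ (f(x, θ̂(y* + z)) − μ(x))² p(z) dz`. -/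
noncomputable def predVar (d n : ℕ) (α β : Fin d → ℝ) (X : Fin n → Fin d → ℝ)
    (θs : Fin (d + 1) → ℝ) (σ : ℝ) (x : Fin d → ℝ) : ℝ :=
  ∫ z : Fin n → ℝ,
    (model d α β x (lse d n α β X (yStar d n α β X θs + z))
        - predMean d n α β X θs σ x) ^ 2 * gauss n σ z

/-- The gradient `∇_θ f(x,θ̄)` of the generic quadratic model:
`∂f/∂θ₀ = 1` and `∂f/∂θₖ = αₖ xₖ + βₖ θ̄ₖ xₖ²`. -/
noncomputable def gradModel (d : ℕ) (α β : Fin d → ℝ) (x : Fin d → ℝ)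
    (θb : Fin (d + 1) → ℝ) : Fin (d + 1) → ℝ :=
  Fin.cons 1 (fun k => α k * x k + β k * θb k.succ * (x k) ^ 2)

/-- The linearized model `f^LIN_θ̄(x,θ) = f(x,θ̄) + ∇_θ f(x,θ̄)ᵀ (θ − θ̄)`. -/
noncomputable def modelLin (d : ℕ) (α β : Fin d → ℝ) (θb : Fin (d + 1) → ℝ)
    (x : Fin d → ℝ) (θ : Fin (d + 1) → ℝ) : ℝ :=
  model d α β x θb + ∑ j, gradModel d α β x θb j * (θ j - θb j)

/-- `c_θ̄(x) = f(x,θ̄) − ∇_θ f(x,θ̄)ᵀ θ̄`. -/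
noncomputable def cRef (d : ℕ) (α β : Fin d → ℝ) (θb : Fin (d + 1) → ℝ)
    (x : Fin d → ℝ) : ℝ :=
  model d α β x θb - ∑ j, gradModel d α β x θb j * θb j

/-- Sum of squared errors of the linearized model. -/
noncomputable def sseLin (d n : ℕ) (α β : Fin d → ℝ) (X : Fin n → Fin d → ℝ)
    (θb : Fin (d + 1) → ℝ) (y : Fin n → ℝ) (θ : Fin (d + 1) → ℝ) : ℝ :=
  ∑ i, (modelLin d α β θb (X i) θ - y i) ^ 2

/-- `g(x,z) = f(x, θ̂(ȳ + z))` where `ȳ` are the predictions of the model estimated from `y`. -/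
noncomputable def spG (d n : ℕ) (α β : Fin d → ℝ) (X : Fin n → Fin d → ℝ)
    (y : Fin n → ℝ) (x : Fin d → ℝ) (z : Fin n → ℝ) : ℝ :=
  model d α β x (lse d n α β X ((fun i => model d α β (X i) (lse d n α β X y)) + z))

/-- The sigma-point approximation to the expected prediction. -/
noncomputable def spMean (d n : ℕ) (α β : Fin d → ℝ) (X : Fin n → Fin d → ℝ)
    (y : Fin n → ℝ) (σ κ : ℝ) (x : Fin d → ℝ) : ℝ :=
  (κ / ((n : ℝ) + κ)) * spG d n α β X y x 0
    + (1 / (2 * ((n : ℝ) + κ))) * ∑ i : Fin n,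
        (spG d n α β X y x (fun j => if j = i then σ * Real.sqrt ((n : ℝ) + κ) else 0)
          + spG d n α β X y x (fun j => if j = i then -(σ * Real.sqrt ((n : ℝ) + κ)) else 0))

/-- The sigma-point approximation to the prediction uncertainty. -/
noncomputable def spVar (d n : ℕ) (α β : Fin d → ℝ) (X : Fin n → Fin d → ℝ)
    (y : Fin n → ℝ) (σ κ : ℝ) (x : Fin d → ℝ) : ℝ :=
  (κ / ((n : ℝ) + κ)) * (spG d n α β X y x 0 - spMean d n α β X y σ κ x) ^ 2
    + (1 / (2 * ((n : ℝ) + κ))) * ∑ i : Fin n,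
        ((spG d n α β X y x (fun j => if j = i then σ * Real.sqrt ((n : ℝ) + κ) else 0)
            - spMean d n α β X y σ κ x) ^ 2
          + (spG d n α β X y x (fun j => if j = i then -(σ * Real.sqrt ((n : ℝ) + κ)) else 0)
              - spMean d n α β X y σ κ x) ^ 2)

open ProbabilityTheory

lemma gauss_eq_prod (n : ℕ) (σ : ℝ) (hσ : 0 < σ) (z : Fin n → ℝ) :
    gauss n σ z = ∏ i, gaussianPDFReal 0 (Real.toNNReal (σ ^ 2)) (z i) := by
  have h0 : (0:ℝ) < 2 * π * σ ^ 2 := by positivity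
  simp only [gauss, gaussianPDFReal, Finset.prod_mul_distrib, ← Real.exp_sum, sub_zero, Real.coe_toNNReal _ (sq_nonneg σ)]
  congr 1
  · simp only [Finset.prod_const, Finset.card_univ, Fintype.card_fin]
    rw [Real.sqrt_eq_rpow, ← Real.rpow_neg h0.le, ← Real.rpow_natCast _ n, ← Real.rpow_mul h0.le]
    congr 1; ring
  · rw [← Finset.sum_div, Finset.sum_neg_distrib]

noncomputable def gP (n : ℕ) (σ : ℝ) : Measure (Fin n → ℝ) :=
  volume.withDensity (fun z => ENNReal.ofReal (gauss n σ z))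

lemma gauss_nonneg' (n : ℕ) (σ : ℝ) (hσ : 0 < σ) (z : Fin n → ℝ) : 0 ≤ gauss n σ z := by
  unfold gauss; positivity

lemma gauss_meas (n : ℕ) (σ : ℝ) : Measurable (gauss n σ) := by
  unfold gauss; fun_prop

lemma int_gP (n : ℕ) (σ : ℝ) (hσ : 0 < σ) (F : (Fin n → ℝ) → ℝ) :
    ∫ z, F z * gauss n σ z = ∫ z, F z ∂(gP n σ) := by
  unfold gP
  rw [integral_withDensity_eq_integral_toReal_smul (gauss_meas n σ).ennreal_ofReal
    (Filter.Eventually.of_forall fun _ => ENNReal.ofReal_lt_top)]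
  refine integral_congr_ae (Filter.Eventually.of_forall fun z => ?_)
  simp only [smul_eq_mul]
  rw [ENNReal.toReal_ofReal (gauss_nonneg' n σ hσ z), mul_comm]

/-- linear forms -/
def lf (n : ℕ) (u : Fin n → ℝ) (z : Fin n → ℝ) : ℝ := ∑ i, u i * z i

lemma mgf_lf (n : ℕ) (σ : ℝ) (hσ : 0 < σ) (u : Fin n → ℝ) (t : ℝ) :
    mgf (lf n u) (gP n σ) t = Real.exp (σ ^ 2 * (∑ i, u i ^ 2) * t ^ 2 / 2) := by
  have hv : (Real.toNNReal (σ ^ 2)) ≠ 0 := by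
    have : 0 < σ ^ 2 := by positivity
    exact (Real.toNNReal_pos.2 this).ne'
  have h1 : ∀ a : ℝ, ∫ y : ℝ, Real.exp (a * y) * gaussianPDFReal 0 (Real.toNNReal (σ ^ 2)) y
      = Real.exp (σ ^ 2 * a ^ 2 / 2) := by
    intro a
    have := congrFun (mgf_id_gaussianReal (μ := 0) (v := (Real.toNNReal (σ ^ 2)))) a
    rw [mgf, integral_gaussianReal_eq_integral_smul hv] at this
    simp only [smul_eq_mul, id, zero_mul, zero_add, Real.coe_toNNReal _ (sq_nonneg σ)] at this
    rw [← this]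
    congr 1; ext y; ring
  unfold mgf
  rw [← int_gP n σ hσ]
  simp only [gauss_eq_prod n σ hσ, lf, Finset.mul_sum, Real.exp_sum, ← Finset.prod_mul_distrib]
  rw [integral_fintype_prod_volume_eq_prod
    (fun i y => Real.exp (t * (u i * y)) * gaussianPDFReal 0 (Real.toNNReal (σ ^ 2)) y)]
  simp only [← mul_assoc, h1, ← Real.exp_sum]
  congr 1
  rw [Finset.sum_mul, Finset.sum_div]
  refine Finset.sum_congr rfl fun i _ => by ring

lemma gP_prob (n : ℕ) (σ : ℝ) (hσ : 0 < σ) : IsProbabilityMeasure (gP n σ) := by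
  have := mgf_lf n σ hσ 0 0
  simp [mgf] at this
  exact ⟨(ENNReal.toReal_eq_one_iff _).1 this⟩

lemma expSet (n : ℕ) (σ : ℝ) (hσ : 0 < σ) (u : Fin n → ℝ) :
    integrableExpSet (lf n u) (gP n σ) = Set.univ := by
  ext t
  simp only [integrableExpSet, Set.mem_ofPred_eq, Set.mem_univ, iff_true]
  by_contra h
  have := mgf_lf n σ hσ u t
  rw [mgf, integral_undef h] at this
  exact (Real.exp_pos _).ne this

lemma memLp_lf (n : ℕ) (σ : ℝ) (hσ : 0 < σ) (u : Fin n → ℝ) (p : NNReal) :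
    MemLp (lf n u) p (gP n σ) :=
  memLp_of_mem_interior_integrableExpSet (by simp [expSet n σ hσ u]) p

lemma derivs (s : ℝ) : iteratedDeriv 2 (fun t : ℝ => Real.exp (s * t ^ 2 / 2)) 0 = s ∧
    iteratedDeriv 4 (fun t : ℝ => Real.exp (s * t ^ 2 / 2)) 0 = 3 * s ^ 2 := by
  have h (p q : ℝ → ℝ) (hp : ∀ t, HasDerivAt p (q t) t) :
      deriv (fun t => p t * Real.exp (s * t ^ 2 / 2))
        = fun t => (q t + p t * (s * t)) * Real.exp (s * t ^ 2 / 2) := by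
    ext t
    have h1 : HasDerivAt (fun t : ℝ => s * t ^ 2 / 2) (s * t) t := by
      have := ((hasDerivAt_pow 2 t).const_mul s).div_const 2
      exact this.congr_deriv (by norm_num; ring)
    rw [HasDerivAt.deriv (f := fun t => p t * Real.exp (s * t ^ 2 / 2)) ((hp t).mul h1.exp)]; ring
  have h0 : (fun t : ℝ => Real.exp (s * t ^ 2 / 2)) = fun t => (fun _ => (1:ℝ)) t * Real.exp (s * t ^ 2 / 2) := by
    ext; simp
  have d1 : deriv (fun t : ℝ => Real.exp (s * t ^ 2 / 2)) = fun t => (fun t => s * t) t * Real.exp (s * t ^ 2 / 2) := by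
    rw [h0, h _ (fun _ => 0) (fun t => hasDerivAt_const t 1)]; ext t; ring
  have d2 : deriv (fun t : ℝ => (fun t => s * t) t * Real.exp (s * t ^ 2 / 2)) = fun t => (fun t => s + s ^ 2 * t ^ 2) t * Real.exp (s * t ^ 2 / 2) := by
    rw [h _ (fun _ => s) (fun t => by simpa using (hasDerivAt_id t).const_mul s)]; ext t; ring
  have d3 : deriv (fun t : ℝ => (fun t => s + s ^ 2 * t ^ 2) t * Real.exp (s * t ^ 2 / 2)) = fun t => (fun t => 3 * s ^ 2 * t + s ^ 3 * t ^ 3) t * Real.exp (s * t ^ 2 / 2) := by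
    rw [h _ (fun t => 2 * s ^ 2 * t) (fun t => by
      exact HasDerivAt.congr_deriv (((hasDerivAt_pow 2 t).const_mul (s ^ 2)).const_add s) (by norm_num; ring))]; ext t; ring
  have d4 : deriv (fun t : ℝ => (fun t => 3 * s ^ 2 * t + s ^ 3 * t ^ 3) t * Real.exp (s * t ^ 2 / 2)) = fun t => (fun t => 3 * s ^ 2 + 6 * s ^ 3 * t ^ 2 + s ^ 4 * t ^ 4) t * Real.exp (s * t ^ 2 / 2) := by
    rw [h _ (fun t => 3 * s ^ 2 + 3 * s ^ 3 * t ^ 2) (fun t => by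
      exact HasDerivAt.congr_deriv (((hasDerivAt_id t).const_mul (3 * s ^ 2)).add ((hasDerivAt_pow 3 t).const_mul (s ^ 3))) (by norm_num; ring))]; ext t; ring
  constructor
  · simp only [iteratedDeriv_succ, iteratedDeriv_zero, d1, d2]; simp
  · simp only [iteratedDeriv_succ, iteratedDeriv_zero, d1, d2, d3, d4]; simp

lemma mom (n : ℕ) (σ : ℝ) (hσ : 0 < σ) (u : Fin n → ℝ) :
    (∫ z, lf n u z ^ 2 ∂(gP n σ)) = σ ^ 2 * ∑ i, u i ^ 2 ∧
    (∫ z, lf n u z ^ 4 ∂(gP n σ)) = 3 * (σ ^ 2 * ∑ i, u i ^ 2) ^ 2 := by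
  have h : mgf (lf n u) (gP n σ) = fun t => Real.exp (σ ^ 2 * (∑ i, u i ^ 2) * t ^ 2 / 2) :=
    funext (mgf_lf n σ hσ u)
  have h0 : (0:ℝ) ∈ interior (integrableExpSet (lf n u) (gP n σ)) := by simp [expSet n σ hσ u]
  have e2 := iteratedDeriv_mgf_zero h0 2
  have e4 := iteratedDeriv_mgf_zero h0 4
  rw [h] at e2 e4
  rw [(derivs _).1] at e2
  rw [(derivs _).2] at e4
  exact ⟨by rw [e2]; rfl, by rw [e4]; rfl⟩

lemma odd_zero (n : ℕ) (σ : ℝ) (hσ : 0 < σ) (F : (Fin n → ℝ) → ℝ) (hF : ∀ z, F (-z) = - F z) :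
    ∫ z, F z ∂(gP n σ) = 0 := by
  rw [← int_gP n σ hσ]
  have := integral_neg_eq_self (fun z => F z * gauss n σ z) volume
  have h2 : ∀ z, gauss n σ (-z) = gauss n σ z := by intro z; simp [gauss]
  simp only [hF, h2, neg_mul, integral_neg] at this
  linarith

lemma lf_sq_memLp (n : ℕ) (σ : ℝ) (hσ : 0 < σ) (u : Fin n → ℝ) :
    MemLp (fun z => lf n u z ^ 2) 2 (gP n σ) := by
  have h := memLp_lf n σ hσ u 4
  have h' : MemLp (lf n u) 4 (gP n σ) := by exact_mod_cast h
  have : MemLp (fun z => lf n u z * lf n u z) 2 (gP n σ) := by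
    have : ENNReal.HolderTriple 4 4 2 := ⟨by
      rw [show (4:ENNReal) = 2 * 2 by norm_num, ENNReal.mul_inv (by simp) (by simp), ← two_mul,
        ← mul_assoc, ENNReal.mul_inv_cancel (by simp) (by simp), one_mul]⟩
    exact h'.mul' h'
  simpa [sq] using this

lemma lf_memLp2 (n : ℕ) (σ : ℝ) (hσ : 0 < σ) (u : Fin n → ℝ) :
    MemLp (lf n u) 2 (gP n σ) := by
  have h := memLp_lf n σ hσ u 2
  exact_mod_cast h

lemma lf_pow4_int (n : ℕ) (σ : ℝ) (hσ : 0 < σ) (u : Fin n → ℝ) :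
    Integrable (fun z => lf n u z ^ 4) (gP n σ) := by
  have := (lf_sq_memLp n σ hσ u).integrable_sq
  refine this.congr (Filter.Eventually.of_forall fun z => by ring)

lemma lf_neg (n : ℕ) (u z : Fin n → ℝ) : lf n u (-z) = - lf n u z := by
  simp [lf]

lemma lf_add_left (n : ℕ) (u v z : Fin n → ℝ) : lf n (u + v) z = lf n u z + lf n v z := by
  simp [lf, add_mul, Finset.sum_add_distrib]

lemma lf_sub_left (n : ℕ) (u v z : Fin n → ℝ) : lf n (u - v) z = lf n u z - lf n v z := by
  simp [lf, sub_mul, Finset.sum_sub_distrib]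

lemma mom22 (n : ℕ) (σ : ℝ) (hσ : 0 < σ) (u v : Fin n → ℝ) (huv : ∑ i, u i * v i = 0) :
    ∫ z, lf n u z ^ 2 * lf n v z ^ 2 ∂(gP n σ)
      = (σ ^ 2 * ∑ i, u i ^ 2) * (σ ^ 2 * ∑ i, v i ^ 2) := by
  have hp : ∑ i, (u + v) i ^ 2 = ∑ i, u i ^ 2 + ∑ i, v i ^ 2 := by
    have : ∀ i, (u + v) i ^ 2 = u i ^ 2 + v i ^ 2 + 2 * (u i * v i) := by
      intro i; simp; ring
    simp only [this, Finset.sum_add_distrib, ← Finset.mul_sum, huv]; ring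
  have hm : ∑ i, (u - v) i ^ 2 = ∑ i, u i ^ 2 + ∑ i, v i ^ 2 := by
    have : ∀ i, (u - v) i ^ 2 = u i ^ 2 + v i ^ 2 - 2 * (u i * v i) := by
      intro i; simp; ring
    simp only [this, Finset.sum_sub_distrib, Finset.sum_add_distrib, ← Finset.mul_sum, huv]; ring
  have e : ∀ z, lf n u z ^ 2 * lf n v z ^ 2 = (1 / 12) * (lf n (u + v) z ^ 4
      + lf n (u - v) z ^ 4 - 2 * lf n u z ^ 4 - 2 * lf n v z ^ 4) := by
    intro z; rw [lf_add_left, lf_sub_left]; ring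
  have i1 := lf_pow4_int n σ hσ (u + v)
  have i2 := lf_pow4_int n σ hσ (u - v)
  have i3 := (lf_pow4_int n σ hσ u).const_mul 2
  have i4 := (lf_pow4_int n σ hσ v).const_mul 2
  simp only [e]
  rw [integral_const_mul, integral_sub ((i1.fun_add i2).sub' i3) i4, integral_sub (i1.fun_add i2) i3,
    integral_add i1 i2, integral_const_mul, integral_const_mul, (mom n σ hσ _).2, (mom n σ hσ _).2,
    (mom n σ hσ _).2, (mom n σ hσ _).2, hp, hm]
  ring

lemma quad_mean (d n : ℕ) (σ : ℝ) (hσ : 0 < σ) (L : Fin n → ℝ) (w : Fin d → Fin n → ℝ)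
    (c C : ℝ) (b : Fin d → ℝ)
    (hw : ∀ k l, ∑ i, w k i * w l i = if k = l then c else 0) :
    ∫ z, (C + lf n L z + ∑ k, b k * lf n (w k) z ^ 2) ∂(gP n σ) = C + σ ^ 2 * c * ∑ k, b k := by
  have := gP_prob n σ hσ
  have hc : ∀ k, ∑ i, w k i ^ 2 = c := fun k => by simpa [sq] using hw k k
  have i1 : ∀ k, Integrable (fun z => b k * lf n (w k) z ^ 2) (gP n σ) := fun k =>
    ((lf_memLp2 n σ hσ (w k)).integrable_sq).const_mul _
  have i2 : Integrable (fun z => lf n L z) (gP n σ) := (lf_memLp2 n σ hσ L).integrable one_le_two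
  rw [integral_add ((integrable_const C).fun_add i2) (integrable_finsetSum _ fun k _ => i1 k),
    integral_add (integrable_const C) i2, integral_finsetSum _ fun k _ => i1 k,
    odd_zero n σ hσ (lf n L) (lf_neg n L)]
  simp only [integral_const_mul, (mom n σ hσ _).1, hc]
  rw [← Finset.sum_mul]; simp; ring

lemma quad_var (d n : ℕ) (σ : ℝ) (hσ : 0 < σ) (L : Fin n → ℝ) (w : Fin d → Fin n → ℝ)
    (c : ℝ) (b : Fin d → ℝ)
    (hw : ∀ k l, ∑ i, w k i * w l i = if k = l then c else 0) :
    ∫ z, (lf n L z + ∑ k, b k * (lf n (w k) z ^ 2 - σ ^ 2 * c)) ^ 2 ∂(gP n σ)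
      = σ ^ 2 * ∑ i, L i ^ 2 + 2 * (σ ^ 2 * c) ^ 2 * ∑ k, b k ^ 2 := by
  have := gP_prob n σ hσ
  have hc : ∀ k, ∑ i, w k i ^ 2 = c := fun k => by simpa [sq] using hw k k
  have mL := lf_memLp2 n σ hσ L
  set T : Fin d → (Fin n → ℝ) → ℝ := fun k z => lf n (w k) z ^ 2 - σ ^ 2 * c with hT
  have mT : ∀ k, MemLp (T k) 2 (gP n σ) := fun k =>
    (lf_sq_memLp n σ hσ (w k)).sub (memLp_const _)
  have iTT : ∀ k l, Integrable (fun z => T k z * T l z) (gP n σ) := fun k l =>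
    (mT k).integrable_mul (mT l)
  have iLT : ∀ k, Integrable (fun z => lf n L z * T k z) (gP n σ) := fun k =>
    mL.integrable_mul (mT k)
  have ELT : ∀ k, ∫ z, lf n L z * T k z ∂(gP n σ) = 0 := fun k =>
    odd_zero n σ hσ _ fun z => by simp only [hT, lf_neg]; ring
  have i2 : ∀ k, Integrable (fun z => lf n (w k) z ^ 2) (gP n σ) := fun k =>
    (lf_memLp2 n σ hσ (w k)).integrable_sq
  have i22 : ∀ k l, Integrable (fun z => lf n (w k) z ^ 2 * lf n (w l) z ^ 2) (gP n σ) :=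
    fun k l => (lf_sq_memLp n σ hσ (w k)).integrable_mul (lf_sq_memLp n σ hσ (w l))
  have ETT0 : ∀ k l, ∫ z, T k z * T l z ∂(gP n σ)
      = ∫ z, lf n (w k) z ^ 2 * lf n (w l) z ^ 2 ∂(gP n σ) - (σ ^ 2 * c) ^ 2 := by
    intro k l
    have e : ∀ z, T k z * T l z = lf n (w k) z ^ 2 * lf n (w l) z ^ 2
        - (σ ^ 2 * c) * lf n (w k) z ^ 2 - (σ ^ 2 * c) * lf n (w l) z ^ 2 + (σ ^ 2 * c) ^ 2 := by
      intro z; simp only [hT]; ring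
    simp only [e]
    rw [integral_add (((i22 k l).sub' ((i2 k).const_mul _)).sub' ((i2 l).const_mul _))
        (integrable_const _),
      integral_sub ((i22 k l).sub' ((i2 k).const_mul _)) ((i2 l).const_mul _),
      integral_sub (i22 k l) ((i2 k).const_mul _), integral_const_mul, integral_const_mul,
      (mom n σ hσ _).1, (mom n σ hσ _).1, hc, hc]
    simp; ring
  have ETT : ∀ k l, ∫ z, T k z * T l z ∂(gP n σ) = if k = l then 2 * (σ ^ 2 * c) ^ 2 else 0 := by
    intro k l
    rw [ETT0]
    split_ifs with h
    · subst h
      have : ∀ z, lf n (w k) z ^ 2 * lf n (w k) z ^ 2 = lf n (w k) z ^ 4 := fun z => by ring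
      simp only [this]
      rw [(mom n σ hσ _).2, hc]; ring
    · rw [mom22 n σ hσ _ _ (by rw [hw, if_neg h]), hc, hc]; ring
  have e : ∀ z, (lf n L z + ∑ k, b k * T k z) ^ 2 = lf n L z ^ 2
      + ∑ k, 2 * b k * (lf n L z * T k z) + ∑ k, ∑ l, (b k * b l) * (T k z * T l z) := by
    intro z
    have h1 : ∑ k, 2 * b k * (lf n L z * T k z) = 2 * lf n L z * ∑ k, b k * T k z := by
      rw [Finset.mul_sum]; exact Finset.sum_congr rfl fun _ _ => by ring
    have h2 : ∑ k, ∑ l, (b k * b l) * (T k z * T l z)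
        = (∑ k, b k * T k z) * (∑ k, b k * T k z) := by
      rw [Finset.sum_mul_sum]
      exact Finset.sum_congr rfl fun _ _ => Finset.sum_congr rfl fun _ _ => by ring
    rw [h1, h2]; ring
  change ∫ z, (lf n L z + ∑ k, b k * T k z) ^ 2 ∂(gP n σ) = _
  simp only [e]
  have j1 : Integrable (fun z => ∑ k, 2 * b k * (lf n L z * T k z)) (gP n σ) :=
    integrable_finsetSum _ fun k _ => (iLT k).const_mul _
  have j3 : ∀ k, Integrable (fun z => ∑ l, (b k * b l) * (T k z * T l z)) (gP n σ) := fun k =>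
    integrable_finsetSum _ fun l _ => (iTT k l).const_mul _
  rw [integral_add (mL.integrable_sq.fun_add j1) (integrable_finsetSum _ fun k _ => j3 k),
    integral_add mL.integrable_sq j1, integral_finsetSum _ fun k _ => (iLT k).const_mul _,
    integral_finsetSum _ fun k _ => j3 k]
  have h3 : ∀ k, ∫ z, ∑ l, (b k * b l) * (T k z * T l z) ∂(gP n σ)
      = 2 * (σ ^ 2 * c) ^ 2 * b k ^ 2 := by
    intro k
    rw [integral_finsetSum _ fun l _ => (iTT k l).const_mul _]
    simp only [integral_const_mul, ETT]
    simp; ring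
  simp only [h3, integral_const_mul, ELT, (mom n σ hσ _).1]
  rw [← Finset.mul_sum]; simp

/-- constant part of the prediction at a corner -/
noncomputable def cst (d : ℕ) (β : Fin d → ℝ) (θ : Fin (d + 1) → ℝ) : ℝ :=
  θ 0 + ∑ k, β k * (θ k.succ) ^ 2 / 2

/-- coefficient of the linear part -/
noncomputable def aC (d : ℕ) (α β : Fin d → ℝ) (θ : Fin (d + 1) → ℝ) (x : Fin d → ℝ)
    (k : Fin d) : ℝ :=
  x k + β k * (x k ^ 2 - 1) * θ k.succ / α k

noncomputable def bC (d : ℕ) (α β : Fin d → ℝ) (x : Fin d → ℝ) (k : Fin d) : ℝ :=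
  β k * (x k ^ 2 - 1) / (2 * α k ^ 2)

noncomputable def wC (d n : ℕ) (X : Fin n → Fin d → ℝ) (k : Fin d) (i : Fin n) : ℝ := X i k / n

noncomputable def LC (d n : ℕ) (X : Fin n → Fin d → ℝ) (a : Fin d → ℝ) (i : Fin n) : ℝ :=
  (1 + ∑ k, a k * X i k) / n

section alg
variable {d n : ℕ} {X : Fin n → Fin d → ℝ}

lemma X_sq (hX : Admissible d n X) (i : Fin n) (k : Fin d) : X i k ^ 2 = 1 := by
  rcases hX.1 i k with h | h <;> rw [h] <;> norm_num

lemma model_corner (hX : Admissible d n X) (α β : Fin d → ℝ) (θ : Fin (d + 1) → ℝ) (i : Fin n) :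
    model d α β (X i) θ = cst d β θ + ∑ k, (α k * θ k.succ) * X i k := by
  simp only [model, cst, X_sq hX, mul_one]; ring

lemma lin_sum (hX : Admissible d n X) (c0 : ℝ) (c : Fin d → ℝ) :
    ∑ i, (c0 + ∑ l, c l * X i l) = n * c0 := by
  rw [Finset.sum_add_distrib, Finset.sum_comm]
  simp only [← Finset.mul_sum, hX.2.1]
  simp

lemma lin_sumX (hX : Admissible d n X) (c0 : ℝ) (c : Fin d → ℝ) (k : Fin d) :
    ∑ i, X i k * (c0 + ∑ l, c l * X i l) = n * c k := by
  have : ∀ i, X i k * (c0 + ∑ l, c l * X i l) = c0 * X i k + ∑ l, c l * (X i k * X i l) := by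
    intro i; rw [mul_add, Finset.mul_sum]
    congr 1
    · ring
    · exact Finset.sum_congr rfl fun _ _ => by ring
  simp only [this]
  rw [Finset.sum_add_distrib, Finset.sum_comm]
  simp only [← Finset.mul_sum, hX.2.1, hX.2.2]
  simp; ring

lemma lin_sq (hX : Admissible d n X) (c0 : ℝ) (c : Fin d → ℝ) :
    ∑ i, (c0 + ∑ l, c l * X i l) ^ 2 = n * (c0 ^ 2 + ∑ k, c k ^ 2) := by
  have : ∀ i, (c0 + ∑ l, c l * X i l) ^ 2 = c0 * (c0 + ∑ l, c l * X i l)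
      + ∑ k, c k * (X i k * (c0 + ∑ l, c l * X i l)) := by
    intro i
    have : ∑ k, c k * (X i k * (c0 + ∑ l, c l * X i l))
        = (∑ k, c k * X i k) * (c0 + ∑ l, c l * X i l) := by
      rw [Finset.sum_mul]; exact Finset.sum_congr rfl fun _ _ => by ring
    rw [this]; ring
  simp only [this]
  rw [Finset.sum_add_distrib, Finset.sum_comm]
  simp only [← Finset.mul_sum, lin_sumX hX, lin_sum hX]
  rw [mul_add, Finset.mul_sum]
  congr 1
  · ring
  · exact Finset.sum_congr rfl fun _ _ => by ring

lemma LC_sq (hX : Admissible d n X) (hn : (n : ℝ) ≠ 0) (a : Fin d → ℝ) :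
    ∑ i, LC d n X a i ^ 2 = (1 + ∑ k, a k ^ 2) / n := by
  simp only [LC, div_pow, ← Finset.sum_div, lin_sq hX]
  field_simp

lemma wC_orth (hX : Admissible d n X) (hn : (n : ℝ) ≠ 0) (k l : Fin d) :
    ∑ i, wC d n X k i * wC d n X l i = if k = l then 1 / (n : ℝ) else 0 := by
  have : ∀ i, wC d n X k i * wC d n X l i = (X i k * X i l) / n ^ 2 := by
    intro i; simp only [wC]; ring
  simp only [this, ← Finset.sum_div, hX.2.2]
  split_ifs
  · field_simp
  · simp

lemma lf_LC (a : Fin d → ℝ) (z : Fin n → ℝ) :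
    lf n (LC d n X a) z = (∑ i, z i) / n + ∑ k, a k * lf n (wC d n X k) z := by
  have h2 : ∑ k, a k * lf n (wC d n X k) z = ∑ i, (∑ k, a k * X i k) * z i / n := by
    simp only [lf, wC, Finset.mul_sum, Finset.sum_mul, Finset.sum_div]
    rw [Finset.sum_comm]
    exact Finset.sum_congr rfl fun _ _ => Finset.sum_congr rfl fun _ _ => by ring
  rw [h2, Finset.sum_div, ← Finset.sum_add_distrib, lf]
  exact Finset.sum_congr rfl fun _ _ => by simp only [LC]; ring

lemma lf_wC (z : Fin n → ℝ) (k : Fin d) : lf n (wC d n X k) z = (∑ i, X i k * z i) / n := by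
  simp only [lf, wC, Finset.sum_div]
  exact Finset.sum_congr rfl fun _ _ => by ring

lemma lse_star (hX : Admissible d n X) (hn : (n : ℝ) ≠ 0) (α β : Fin d → ℝ) (hα : ∀ k, α k ≠ 0)
    (θs : Fin (d + 1) → ℝ) (z : Fin n → ℝ) :
    lse d n α β X (yStar d n α β X θs + z) =
      Fin.cons (cst d β θs + (∑ i, z i) / n
        - ∑ k, β k / 2 * (θs k.succ + lf n (wC d n X k) z / α k) ^ 2)
        (fun k => θs k.succ + lf n (wC d n X k) z / α k) := by
  have h0 : ∑ i, (yStar d n α β X θs + z) i = n * cst d β θs + ∑ i, z i := by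
    simp only [Pi.add_apply, yStar, model_corner hX, Finset.sum_add_distrib (g := z), lin_sum hX]
  have h1 : ∀ k, ∑ i, X i k * (yStar d n α β X θs + z) i
      = n * (α k * θs k.succ) + n * lf n (wC d n X k) z := by
    intro k
    simp only [Pi.add_apply, yStar, model_corner hX, mul_add (X _ _) (_ + _) (z _),
      Finset.sum_add_distrib, lin_sumX hX, lf_wC]
    field_simp
  unfold lse
  rw [h0]
  simp only [h1]
  congr 1
  · congr 1
    · field_simp
    · refine Finset.sum_congr rfl fun k _ => ?_
      have := hα k
      field_simp
  · ext k
    have := hα k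
    field_simp

lemma pred (hX : Admissible d n X) (hn : (n : ℝ) ≠ 0) (α β : Fin d → ℝ) (hα : ∀ k, α k ≠ 0)
    (θs : Fin (d + 1) → ℝ) (z : Fin n → ℝ) (x : Fin d → ℝ) :
    model d α β x (lse d n α β X (yStar d n α β X θs + z)) =
      model d α β x θs + lf n (LC d n X (aC d α β θs x)) z
        + ∑ k, bC d α β x k * lf n (wC d n X k) z ^ 2 := by
  rw [lse_star hX hn α β hα, lf_LC]
  simp only [model, Fin.cons_zero, Fin.cons_succ, cst]
  have : ∀ A B C D E G H I J T : ℝ, (B - C + D + E = G + H + I + J) →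
     T + B + A - C + D + E = T + G + H + (A + I) + J := by intros; linarith
  apply this
  rw [← Finset.sum_sub_distrib, ← Finset.sum_add_distrib, ← Finset.sum_add_distrib, ← Finset.sum_add_distrib,
    ← Finset.sum_add_distrib, ← Finset.sum_add_distrib]
  refine Finset.sum_congr rfl fun k _ => ?_
  have := hα k
  simp only [aC, bC]
  field_simp
  ring

lemma lse_star0 (hX : Admissible d n X) (hn : (n : ℝ) ≠ 0) (α β : Fin d → ℝ) (hα : ∀ k, α k ≠ 0)
    (θs : Fin (d + 1) → ℝ) : lse d n α β X (yStar d n α β X θs) = θs := by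
  have := lse_star hX hn α β hα θs 0
  rw [add_zero] at this
  rw [this]
  have h : ∀ k, lf n (wC d n X k) 0 = 0 := fun k => by simp [lf]
  ext j
  refine Fin.cases ?_ (fun k => ?_) j
  · simp only [Fin.cons_zero, h, cst]
    have : ∀ k, β k / 2 * (θs k.succ + 0 / α k) ^ 2 = β k * θs k.succ ^ 2 / 2 := by
      intro k; simp; ring
    simp only [this]; simp
  · simp [h]

lemma modelLin_eq (α β : Fin d → ℝ) (hα : ∀ k, α k ≠ 0) (θb θ : Fin (d + 1) → ℝ) (x : Fin d → ℝ) :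
    modelLin d α β θb x θ = model d α β x θb
      + ((θ 0 - θb 0) + ∑ k, β k * θb k.succ * (θ k.succ - θb k.succ))
      + ∑ k, aC d α β θb x k * (α k * (θ k.succ - θb k.succ)) := by
  rw [modelLin, Fin.sum_univ_succ]
  simp only [gradModel, Fin.cons_zero, Fin.cons_succ]
  rw [one_mul, add_assoc, add_assoc, ← Finset.sum_add_distrib]
  congr 2
  refine Finset.sum_congr rfl fun k _ => ?_
  have := hα k
  simp only [aC]; field_simp; ring

lemma sse_expand (hX : Admissible d n X) (hn : (n : ℝ) ≠ 0) (c0 : ℝ) (c : Fin d → ℝ)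
    (z : Fin n → ℝ) :
    ∑ i, ((c0 + ∑ k, c k * X i k) - z i) ^ 2 = n * (c0 - (∑ i, z i) / n) ^ 2
      + n * ∑ k, (c k - lf n (wC d n X k) z) ^ 2
      + (∑ i, z i ^ 2 - n * ((∑ i, z i) / n) ^ 2 - n * ∑ k, lf n (wC d n X k) z ^ 2) := by
  have e : ∀ i, ((c0 + ∑ k, c k * X i k) - z i) ^ 2 = (c0 + ∑ k, c k * X i k) ^ 2
      - 2 * (c0 * z i + ∑ k, c k * (X i k * z i)) + z i ^ 2 := by
    intro i
    have : ∑ k, c k * (X i k * z i) = (∑ k, c k * X i k) * z i := by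
      rw [Finset.sum_mul]; exact Finset.sum_congr rfl fun _ _ => by ring
    rw [this]; ring
  have hc : ∑ i, ∑ k, c k * (X i k * z i) = n * ∑ k, c k * lf n (wC d n X k) z := by
    rw [Finset.sum_comm, Finset.mul_sum]
    refine Finset.sum_congr rfl fun k _ => ?_
    rw [← Finset.mul_sum, lf_wC]; field_simp
  have h3 : ∑ k, (c k - lf n (wC d n X k) z) ^ 2 = ∑ k, c k ^ 2
      - 2 * ∑ k, c k * lf n (wC d n X k) z + ∑ k, lf n (wC d n X k) z ^ 2 := by
    rw [Finset.mul_sum, ← Finset.sum_sub_distrib, ← Finset.sum_add_distrib]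
    exact Finset.sum_congr rfl fun _ _ => by ring
  simp only [e]
  rw [Finset.sum_add_distrib, Finset.sum_sub_distrib, lin_sq hX, ← Finset.mul_sum,
    Finset.sum_add_distrib, ← Finset.mul_sum, hc, h3]
  field_simp
  ring

lemma sseLin_eq (hX : Admissible d n X) (hn : (n : ℝ) ≠ 0) (α β : Fin d → ℝ) (hα : ∀ k, α k ≠ 0)
    (θs θ : Fin (d + 1) → ℝ) (z : Fin n → ℝ) :
    sseLin d n α β X θs (yStar d n α β X θs + z) θ =
      n * (((θ 0 - θs 0) + ∑ k, β k * θs k.succ * (θ k.succ - θs k.succ)) - (∑ i, z i) / n) ^ 2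
      + n * ∑ k, (α k * (θ k.succ - θs k.succ) - lf n (wC d n X k) z) ^ 2
      + (∑ i, z i ^ 2 - n * ((∑ i, z i) / n) ^ 2 - n * ∑ k, lf n (wC d n X k) z ^ 2) := by
  rw [← sse_expand hX hn]
  unfold sseLin
  refine Finset.sum_congr rfl fun i _ => ?_
  rw [modelLin_eq α β hα]
  have : ∀ k, aC d α β θs (X i) k = X i k := fun k => by simp [aC, X_sq hX]
  simp only [this, Pi.add_apply, yStar, mul_comm (X i _)]
  congr 1; ring

lemma predLin (hX : Admissible d n X) (hn : 0 < (n : ℝ)) (α β : Fin d → ℝ) (hα : ∀ k, α k ≠ 0)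
    (θs θ : Fin (d + 1) → ℝ) (z : Fin n → ℝ)
    (hmin : ∀ θ', sseLin d n α β X θs (yStar d n α β X θs + z) θ
      ≤ sseLin d n α β X θs (yStar d n α β X θs + z) θ') (x : Fin d → ℝ) :
    modelLin d α β θs x θ = model d α β x θs + lf n (LC d n X (aC d α β θs x)) z := by
  have h := hmin (Fin.cons (θs 0 + (∑ i, z i) / n - ∑ k, β k * θs k.succ * (lf n (wC d n X k) z / α k))
    (fun k => θs k.succ + lf n (wC d n X k) z / α k))
  rw [sseLin_eq hX hn.ne' α β hα, sseLin_eq hX hn.ne' α β hα] at h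
  simp only [Fin.cons_zero, Fin.cons_succ, add_sub_cancel_left] at h
  have h1 : ∀ k, α k * (lf n (wC d n X k) z / α k) - lf n (wC d n X k) z = 0 := fun k => by
    have := hα k
    field_simp; ring
  simp only [h1] at h
  set u := (θ 0 - θs 0 + ∑ k, β k * θs k.succ * (θ k.succ - θs k.succ)) - (∑ i, z i) / n with hu
  have hs : 0 ≤ ∑ k, (α k * (θ k.succ - θs k.succ) - lf n (wC d n X k) z) ^ 2 :=
    Finset.sum_nonneg fun _ _ => sq_nonneg _
  have h2 : n * u ^ 2 + n * ∑ k, (α k * (θ k.succ - θs k.succ) - lf n (wC d n X k) z) ^ 2 ≤ 0 := by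
    ring_nf at h ⊢
    simp at h
    linarith
  have hu0 : u ^ 2 ≤ 0 := by
    by_contra hc
    push Not at hc
    nlinarith [mul_pos hn hc, mul_nonneg hn.le hs]
  have hs0 : ∑ k, (α k * (θ k.succ - θs k.succ) - lf n (wC d n X k) z) ^ 2 = 0 := by
    refine le_antisymm ?_ hs
    by_contra hc
    push Not at hc
    nlinarith [mul_pos hn hc, mul_nonneg hn.le (sq_nonneg u)]
  have hu1 : u = 0 := by nlinarith [sq_nonneg u, pow_eq_zero_iff (two_ne_zero) |>.1 (le_antisymm hu0 (sq_nonneg u))]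
  have hk : ∀ k, α k * (θ k.succ - θs k.succ) = lf n (wC d n X k) z := by
    intro k
    have := (Finset.sum_eq_zero_iff_of_nonneg (fun k _ => sq_nonneg _)).1 hs0 k (Finset.mem_univ k)
    have := pow_eq_zero_iff (two_ne_zero) |>.1 this
    linarith
  rw [modelLin_eq α β hα, lf_LC]
  simp only [hk]
  linarith
end alg

lemma lf_single (n : ℕ) (u : Fin n → ℝ) (i : Fin n) (t : ℝ) :
    lf n u (fun j => if j = i then t else 0) = u i * t := by
  simp [lf]

lemma spVar_eq {d n : ℕ} {X : Fin n → Fin d → ℝ} (hX : Admissible d n X) (hn : 0 < (n : ℝ))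
    (α β : Fin d → ℝ) (hα : ∀ k, α k ≠ 0)
    (θs : Fin (d + 1) → ℝ) (σ κ : ℝ) (hκ : 0 < (n : ℝ) + κ) (x : Fin d → ℝ) :
    spVar d n α β X (yStar d n α β X θs) σ κ x
      = σ ^ 2 * ∑ i, LC d n X (aC d α β θs x) i ^ 2
        + (σ ^ 2 * (1 / n)) ^ 2 * (κ / n) * (∑ k, bC d α β x k) ^ 2 := by
  set a := aC d α β θs x
  set B := ∑ k, bC d α β x k with hB
  set C := model d α β x θs
  have hg : ∀ z, spG d n α β X (yStar d n α β X θs) x z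
      = C + lf n (LC d n X a) z + ∑ k, bC d α β x k * lf n (wC d n X k) z ^ 2 := by
    intro z
    rw [spG, lse_star0 hX hn.ne' α β hα]
    exact pred hX hn.ne' α β hα θs z x
  have hg0 : spG d n α β X (yStar d n α β X θs) x 0 = C := by
    rw [hg]; simp [lf]
  have hg1 : ∀ i t, spG d n α β X (yStar d n α β X θs) x (fun j => if j = i then t else 0)
      = C + LC d n X a i * t + B * (t ^ 2 / n ^ 2) := by
    intro i t
    rw [hg, lf_single, hB, Finset.sum_mul]
    congr 1
    refine Finset.sum_congr rfl fun k _ => ?_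
    rw [lf_single, wC, mul_pow, div_pow, X_sq hX]; ring
  set δ := σ * Real.sqrt ((n : ℝ) + κ)
  have hδ : δ ^ 2 = σ ^ 2 * (n + κ) := by
    rw [mul_pow, Real.sq_sqrt hκ.le]
  have hm : spMean d n α β X (yStar d n α β X θs) σ κ x = C + σ ^ 2 * B / n := by
    rw [spMean, hg0]
    have : ∀ i : Fin n, spG d n α β X (yStar d n α β X θs) x (fun j => if j = i then δ else 0)
          + spG d n α β X (yStar d n α β X θs) x (fun j => if j = i then -δ else 0)
        = 2 * C + 2 * B * (σ ^ 2 * (n + κ)) / n ^ 2 := by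
      intro i; rw [hg1, hg1, neg_sq, hδ]; ring
    simp only [δ] at this
    simp only [this, Finset.sum_const, Finset.card_univ, Fintype.card_fin, nsmul_eq_mul]
    field_simp
    ring
  rw [spVar, hm, hg0]
  have : ∀ i : Fin n, (spG d n α β X (yStar d n α β X θs) x (fun j => if j = i then δ else 0)
          - (C + σ ^ 2 * B / n)) ^ 2
          + (spG d n α β X (yStar d n α β X θs) x (fun j => if j = i then -δ else 0)
          - (C + σ ^ 2 * B / n)) ^ 2
        = (2 * (σ ^ 2 * (n + κ))) * LC d n X a i ^ 2 + 2 * (σ ^ 2 * B * κ / n ^ 2) ^ 2 := by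
    intro i; rw [hg1, hg1, neg_sq, ← hδ]
    have e : B * (δ ^ 2 / n ^ 2) = σ ^ 2 * B / n + σ ^ 2 * B * κ / n ^ 2 := by
      rw [hδ]; field_simp
    rw [e]; ring
  simp only [δ] at this
  simp only [this, Finset.sum_add_distrib, ← Finset.mul_sum, Finset.sum_const, Finset.card_univ,
    Fintype.card_fin, nsmul_eq_mul]
  field_simp
  ring

lemma b_ineq {d : ℕ} (b : Fin d → ℝ) (h : (∀ k, b k ≤ 0) ∨ (∀ k, 0 ≤ b k)) :
    ∑ k, b k ^ 2 ≤ (∑ k, b k) ^ 2 := by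
  rcases h with h | h
  · have := Finset.sum_sq_le_sq_sum_of_nonneg (s := Finset.univ) (f := fun k => - b k)
      (fun k _ => by simpa using h k)
    simpa using this
  · exact Finset.sum_sq_le_sq_sum_of_nonneg (fun k _ => h k)

/-- With noise-free observations, quadratic coefficients of a common
strict sign and `κ > 2n`, the strict inequalities `V^LIN(x) < V(x) < V^SP(x)` hold at every
input point having at least one coordinate in the open interval `(-1,1)`. -/
theorem stmt16 (d n : ℕ) (hd : 1 ≤ d) (hn : 1 ≤ n)
    (α β : Fin d → ℝ) (hα : ∀ k, α k ≠ 0)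
    (hβ : (∀ k, 0 < β k) ∨ (∀ k, β k < 0))
    (X : Fin n → Fin d → ℝ) (hX : Admissible d n X)
    (θs : Fin (d + 1) → ℝ) (σ κ : ℝ) (hσ : 0 < σ) (hκ : 2 * (n : ℝ) < κ)
    (θb : Fin (d + 1) → ℝ) (hθb : θb = lse d n α β X (yStar d n α β X θs))
    (tLin : (Fin n → ℝ) → Fin (d + 1) → ℝ)
    (hmin : ∀ (w : Fin n → ℝ) (θ : Fin (d + 1) → ℝ),
      sseLin d n α β X θb w (tLin w) ≤ sseLin d n α β X θb w θ)
    (x : Fin d → ℝ) (hx : ∀ k, x k ∈ Set.Icc (-1 : ℝ) 1)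
    (hx' : ∃ k, -1 < x k ∧ x k < 1) :
    (∫ z : Fin n → ℝ,
        (modelLin d α β θb x (tLin (yStar d n α β X θs + z))
            - ∫ w : Fin n → ℝ,
                modelLin d α β θb x (tLin (yStar d n α β X θs + w)) * gauss n σ w) ^ 2
          * gauss n σ z)
        < predVar d n α β X θs σ x
      ∧ predVar d n α β X θs σ x < spVar d n α β X (yStar d n α β X θs) σ κ x := by
  have hn0 : 0 < (n : ℝ) := by exact_mod_cast hn
  have hn1 := hn0.ne'
  have hw := wC_orth hX hn1
  rw [lse_star0 hX hn1 α β hα] at hθb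
  subst hθb
  set a := aC d α β θb x with ha
  set b := bC d α β x with hb
  set L := LC d n X a with hL
  have hb2 : 0 < ∑ k, b k ^ 2 := by
    obtain ⟨k, hk1, hk2⟩ := hx'
    refine Finset.sum_pos' (fun _ _ => sq_nonneg _) ⟨k, Finset.mem_univ k, ?_⟩
    have hβk : β k ≠ 0 := by
      rcases hβ with h | h
      · exact (h k).ne'
      · exact (h k).ne
    have hxk : x k ^ 2 - 1 ≠ 0 := by nlinarith
    have hαk := hα k
    have : b k ≠ 0 := by
      simp only [hb, bC]
      exact div_ne_zero (mul_ne_zero hβk hxk) (by positivity)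
    positivity
  have hbs : (∀ k, b k ≤ 0) ∨ (∀ k, 0 ≤ b k) := by
    have hxk : ∀ k, x k ^ 2 - 1 ≤ 0 := fun k => by nlinarith [(hx k).1, (hx k).2]
    rcases hβ with h | h
    · left; intro k
      exact div_nonpos_of_nonpos_of_nonneg (mul_nonpos_of_nonneg_of_nonpos (h k).le (hxk k))
        (by positivity)
    · right; intro k
      exact div_nonneg (mul_nonneg_of_nonpos_of_nonpos (h k).le (hxk k)) (by positivity)
  have hVL : (∫ z : Fin n → ℝ,
        (modelLin d α β θb x (tLin (yStar d n α β X θb + z))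
            - ∫ w : Fin n → ℝ,
                modelLin d α β θb x (tLin (yStar d n α β X θb + w)) * gauss n σ w) ^ 2
          * gauss n σ z) = σ ^ 2 * ∑ i, L i ^ 2 := by
    have hp : ∀ z, modelLin d α β θb x (tLin (yStar d n α β X θb + z))
        = model d α β x θb + lf n L z := fun z =>
      predLin hX hn0 α β hα θb _ z (hmin _) x
    simp only [hp]
    rw [int_gP n σ hσ, int_gP n σ hσ]
    have hm := quad_mean d n σ hσ L (wC d n X) (1 / n) (model d α β x θb) 0 hw
    have hv := quad_var d n σ hσ L (wC d n X) (1 / n) 0 hw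
    simp at hm hv
    rw [hm]
    simpa using hv
  have hV : predVar d n α β X θb σ x
      = σ ^ 2 * ∑ i, L i ^ 2 + 2 * (σ ^ 2 * (1 / n)) ^ 2 * ∑ k, b k ^ 2 := by
    rw [predVar, int_gP n σ hσ, predMean, int_gP n σ hσ]
    simp only [pred hX hn1 α β hα]
    rw [quad_mean d n σ hσ L (wC d n X) (1 / n) (model d α β x θb) b hw,
      ← quad_var d n σ hσ L (wC d n X) (1 / n) b hw]
    congr 1; ext z
    simp only [mul_sub, Finset.sum_sub_distrib, ← Finset.sum_mul]
    ring
  rw [hVL, hV, spVar_eq hX hn0 α β hα θb σ κ (by linarith) x]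
  have hc : 0 < (σ ^ 2 * (1 / (n : ℝ))) ^ 2 := by positivity
  refine ⟨?_, ?_⟩
  · have := mul_pos hc hb2
    linarith
  · have h1 := b_ineq b hbs
    have h2 : 2 < κ / n := by rw [lt_div_iff₀ hn0]; exact hκ
    have h3 : 2 * ∑ k, b k ^ 2 < κ / n * (∑ k, b k) ^ 2 := by nlinarith
    have := mul_lt_mul_of_pos_left h3 hc
    linarith
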